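/- arXiv:2003.09495 — 2 statements merged into one kernel-verified Lean document; each statement's English description precedes it below -/
import Mathlib

section
/- Let ∅ ≠ A ⊆ ℝⁿ and B ⊆ ℕⁿ \ (2ℕ)ⁿ be disjoint finite sets. A coefficient vector (c, d) ∈ ℝ^A × ℝ^B lies in the S-cone C_S(A, B) if and only if there exists t ∈ ℝ^B with t_β ≤ −|d_β| for all β ∈ B such that (c, t) ∈ C_SAGE(A ∪ B). -/
attribute [local instance] Classical.propDecidable

noncomputable section

/-- Embedding of exponent vectors with natural entries into `ℝⁿ`. -/
def natEmb (n : ℕ) (β : Fin n → ℕ) : Fin n → ℝ := fun i => (β i : ℝ)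

/-- `(c, d)` is the coefficient vector of a nonnegative AG function supported on `(A, B)`:
either an even AG function (all `d` vanish and at most one `c_α` is negative) or an odd AG
function (`c ≥ 0` and at most one `d_β` nonzero), which is nonnegative on all points of `ℝⁿ`
with nonzero coordinates. -/
def IsNonnegAG (n : ℕ) (A : Finset (Fin n → ℝ)) (B : Finset (Fin n → ℕ))
    (c : (Fin n → ℝ) → ℝ) (d : (Fin n → ℕ) → ℝ) : Prop :=
  (((∀ β ∈ B, d β = 0) ∧ (A.filter fun α => c α < 0).card ≤ 1) ∨
      ((∀ α ∈ A, 0 ≤ c α) ∧ (B.filter fun β => d β ≠ 0).card ≤ 1)) ∧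
    ∀ x : Fin n → ℝ, (∀ i, x i ≠ 0) →
      0 ≤ ∑ α ∈ A, c α * ∏ i, |x i| ^ (α i)
            + ∑ β ∈ B, d β * ∏ i, (x i) ^ (β i)

/-- Membership in the S-cone `C_S(A, B)` (as a statement about the values of the
coefficient vector `(c, d) ∈ ℝ^A × ℝ^B`): the vector is a finite nonnegative combination of
coefficient vectors of nonnegative AG functions. -/
def InSCone (n : ℕ) (A : Finset (Fin n → ℝ)) (B : Finset (Fin n → ℕ))
    (c : (Fin n → ℝ) → ℝ) (d : (Fin n → ℕ) → ℝ) : Prop :=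
  ∃ (k : ℕ) (cs : Fin k → ((Fin n → ℝ) → ℝ)) (ds : Fin k → ((Fin n → ℕ) → ℝ))
      (t : Fin k → ℝ),
    (∀ j, 0 ≤ t j ∧ IsNonnegAG n A B (cs j) (ds j)) ∧
    (∀ α ∈ A, c α = ∑ j, t j * cs j α) ∧
    (∀ β ∈ B, d β = ∑ j, t j * ds j β)

/-- Membership in `C_AGE(T \ {β}, β) ⊆ ℝ^T`. -/
def InAGE (n : ℕ) (T : Finset (Fin n → ℝ)) (β : Fin n → ℝ) (v : (Fin n → ℝ) → ℝ) : Prop :=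
  (∀ α ∈ T, α ≠ β → 0 ≤ v α) ∧
    ∀ y : Fin n → ℝ, 0 ≤ ∑ α ∈ T, v α * Real.exp (∑ i, α i * y i)

/-- Membership in the SAGE cone `C_SAGE(T) = Σ_{β ∈ T} C_AGE(T \ {β}, β) ⊆ ℝ^T`. -/
def InSAGE (n : ℕ) (T : Finset (Fin n → ℝ)) (v : (Fin n → ℝ) → ℝ) : Prop :=
  ∃ w : (Fin n → ℝ) → (Fin n → ℝ) → ℝ,
    (∀ β ∈ T, InAGE n T β (w β)) ∧ ∀ α ∈ T, v α = ∑ β ∈ T, w β α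


lemma natEmb_inj (n : ℕ) : Function.Injective (natEmb n) := by
  intro a b h
  funext i
  have := congrFun h i
  simpa [natEmb] using this

lemma sum_filter_natEmb (n : ℕ) (B : Finset (Fin n → ℕ)) (t : (Fin n → ℕ) → ℝ)
    (β : Fin n → ℕ) (hβ : β ∈ B) :
    ∑ b ∈ B.filter (fun b => natEmb n b = natEmb n β), t b = t β := by
  have : B.filter (fun b => natEmb n b = natEmb n β) = {β} := by
    ext b
    simp only [Finset.mem_filter, Finset.mem_singleton]
    constructor
    · rintro ⟨_, h⟩
      exact natEmb_inj n h
    · rintro rfl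
      exact ⟨hβ, rfl⟩
  rw [this, Finset.sum_singleton]

lemma sum_split (n : ℕ) (A : Finset (Fin n → ℝ)) (B : Finset (Fin n → ℕ))
    (hdisj : ∀ β ∈ B, natEmb n β ∉ A) (f : (Fin n → ℝ) → ℝ) :
    ∑ γ ∈ A ∪ B.image (natEmb n), f γ = ∑ α ∈ A, f α + ∑ β ∈ B, f (natEmb n β) := by
  rw [Finset.sum_union, Finset.sum_image]
  · intro a _ b _ h
    exact natEmb_inj n h
  · rw [Finset.disjoint_left]
    intro a ha hb
    obtain ⟨b, hbB, rfl⟩ := Finset.mem_image.1 hb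
    exact hdisj b hbB ha

lemma prod_abs_eq (n : ℕ) (x : Fin n → ℝ) (hx : ∀ i, x i ≠ 0) (α : Fin n → ℝ) :
    ∏ i, |x i| ^ (α i) = Real.exp (∑ i, α i * Real.log |x i|) := by
  rw [Real.exp_sum]
  refine Finset.prod_congr rfl fun i _ => ?_
  rw [Real.rpow_def_of_pos (abs_pos.2 (hx i)), mul_comm]

lemma abs_prod_eq (n : ℕ) (x : Fin n → ℝ) (hx : ∀ i, x i ≠ 0) (β : Fin n → ℕ) :
    |∏ i, (x i) ^ (β i)| = Real.exp (∑ i, natEmb n β i * Real.log |x i|) := by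
  rw [← prod_abs_eq n x hx, Finset.abs_prod]
  refine Finset.prod_congr rfl fun i _ => ?_
  rw [abs_pow, natEmb, Real.rpow_natCast]

lemma elim_step (n : ℕ) (T : Finset (Fin n → ℝ)) (v : (Fin n → ℝ) → ℝ)
    (h : InSAGE n T v) (K : Finset (Fin n → ℝ)) (hKT : K ⊆ T) (hK : ∀ k ∈ K, v k ≤ 0) :
    ∃ w : (Fin n → ℝ) → (Fin n → ℝ) → ℝ,
      (∀ β ∈ T, InAGE n T β (w β)) ∧ (∀ α ∈ T, v α = ∑ β ∈ T, w β α) ∧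
      ∀ k ∈ K, ∀ β ∈ T, β ≠ k → w β k = 0 := by
  induction K using Finset.induction_on with
  | empty =>
    obtain ⟨w, h1, h2⟩ := h
    exact ⟨w, h1, h2, by simp⟩
  | insert k K hkK ih =>
    obtain ⟨w, h1, h2, h3⟩ := ih (fun a ha => hKT (Finset.mem_insert_of_mem ha))
      (fun a ha => hK a (Finset.mem_insert_of_mem ha))
    have hkT : k ∈ T := hKT (Finset.mem_insert_self _ _)
    have hvk : v k ≤ 0 := hK k (Finset.mem_insert_self _ _)
    have hsum := h2 k hkT
    rw [← Finset.add_sum_erase T _ hkT] at hsum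
    have hnn : ∀ β ∈ T.erase k, 0 ≤ w β k := fun β hβ =>
      (h1 β (Finset.mem_of_mem_erase hβ)).1 k hkT (Finset.ne_of_mem_erase hβ).symm
    have hSnn := Finset.sum_nonneg hnn
    by_cases hS : ∑ β ∈ T.erase k, w β k = 0
    · have hz := (Finset.sum_eq_zero_iff_of_nonneg hnn).1 hS
      refine ⟨w, h1, h2, ?_⟩
      intro k' hk' β hβ hne
      rcases Finset.mem_insert.1 hk' with rfl | hk'
      · exact hz β (Finset.mem_erase.2 ⟨hne, hβ⟩)
      · exact h3 k' hk' β hβ hne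
    · have hSpos : 0 < ∑ β ∈ T.erase k, w β k := lt_of_le_of_ne hSnn (Ne.symm hS)
      have hwk : 0 < -(w k k) := by linarith
      set S := ∑ β ∈ T.erase k, w β k with hSdef
      have hwk0 : w k k ≠ 0 := by linarith
      -- multipliers
      let l : (Fin n → ℝ) → ℝ := fun β => w β k / (-(w k k))
      have hlnn : ∀ β ∈ T, β ≠ k → 0 ≤ l β := fun β hβ hne =>
        div_nonneg (hnn β (Finset.mem_erase.2 ⟨hne, hβ⟩)) hwk.le
      have hlsum : ∑ β ∈ T.erase k, l β = S / (-(w k k)) := by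
        rw [hSdef, Finset.sum_div]
      have hmu : 0 ≤ 1 - S / (-(w k k)) := by
        rw [sub_nonneg, div_le_one hwk]; linarith
      refine ⟨fun β α => if β = k then (1 - S / (-(w k k))) * w k α
        else w β α + l β * w k α, ?_, ?_, ?_⟩
      · intro β hβ
        by_cases hbk : β = k
        · subst hbk
          simp only [if_true]
          refine ⟨fun α hα hne => mul_nonneg hmu ((h1 β hβ).1 α hα hne), fun y => ?_⟩
          have := mul_nonneg hmu ((h1 β hβ).2 y)
          rw [Finset.mul_sum] at this
          simpa only [mul_assoc] using this
        · simp only [if_neg hbk]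
          refine ⟨fun α hα hne => ?_, fun y => ?_⟩
          · by_cases hak : α = k
            · subst hak
              have : w β α + l β * w α α = 0 := by
                simp only [l]; field_simp; ring
              exact this.ge
            · exact add_nonneg ((h1 β hβ).1 α hα hne)
                (mul_nonneg (hlnn β hβ hbk) ((h1 k hkT).1 α hα hak))
          · have e1 := (h1 β hβ).2 y
            have e2 := mul_nonneg (hlnn β hβ hbk) ((h1 k hkT).2 y)
            rw [Finset.mul_sum] at e2
            have e3 := add_nonneg e1 e2
            rw [← Finset.sum_add_distrib] at e3
            simpa only [add_mul, mul_assoc] using e3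
      · intro α hα
        rw [h2 α hα, ← Finset.add_sum_erase T _ hkT, ← Finset.add_sum_erase T _ hkT]
        have : ∑ β ∈ T.erase k, (if β = k then (1 - S / (-(w k k))) * w k α
            else w β α + l β * w k α) = ∑ β ∈ T.erase k, (w β α + l β * w k α) :=
          Finset.sum_congr rfl fun β hβ => if_neg (Finset.ne_of_mem_erase hβ)
        rw [this, Finset.sum_add_distrib, ← Finset.sum_mul, hlsum]
        simp only [if_true]
        ring
      · intro k' hk' β hβ hne
        rcases Finset.mem_insert.1 hk' with rfl | hk'
        · simp only [if_neg hne, l]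
          field_simp
          ring
        · have hkk' : k ≠ k' := by
            rintro rfl
            exact hkK hk'
          have e1 := h3 k' hk' k hkT hkk'
          have e2 := h3 k' hk' β hβ hne
          simp [e1, e2]

lemma inAGE_sum (n : ℕ) (T : Finset (Fin n → ℝ)) (β : Fin n → ℝ) (k : ℕ)
    (u : Fin k → (Fin n → ℝ) → ℝ) (h : ∀ j, InAGE n T β (u j)) :
    InAGE n T β (fun α => ∑ j, u j α) := by
  refine ⟨fun α hα hne => Finset.sum_nonneg fun j _ => (h j).1 α hα hne, fun y => ?_⟩
  simp only [Finset.sum_mul]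
  rw [Finset.sum_comm]
  exact Finset.sum_nonneg fun j _ => (h j).2 y

lemma inAGE_smul (n : ℕ) (T : Finset (Fin n → ℝ)) (β : Fin n → ℝ) (s : ℝ) (hs : 0 ≤ s)
    (u : (Fin n → ℝ) → ℝ) (h : InAGE n T β u) :
    InAGE n T β (fun α => s * u α) := by
  refine ⟨fun α hα hne => mul_nonneg hs (h.1 α hα hne), fun y => ?_⟩
  have := mul_nonneg hs (h.2 y)
  rw [Finset.mul_sum] at this
  simpa only [mul_assoc] using this

lemma inAGE_zero (n : ℕ) (T : Finset (Fin n → ℝ)) (β : Fin n → ℝ) :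
    InAGE n T β (fun _ => 0) := by
  refine ⟨fun _ _ _ => le_rfl, fun y => ?_⟩
  simp

lemma inSAGE_comb (n : ℕ) (T : Finset (Fin n → ℝ)) (k : ℕ)
    (u : Fin k → (Fin n → ℝ) → ℝ) (t : Fin k → ℝ) (ht : ∀ j, 0 ≤ t j)
    (h : ∀ j, ∃ β ∈ T, InAGE n T β (u j)) (v : (Fin n → ℝ) → ℝ)
    (hv : ∀ α ∈ T, v α = ∑ j, t j * u j α) : InSAGE n T v := by
  choose b hb hu using h
  refine ⟨fun β α => ∑ j, if b j = β then t j * u j α else 0, fun β _ => ?_, fun α hα => ?_⟩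
  · refine inAGE_sum n T β k (fun j α => if b j = β then t j * u j α else 0) fun j => ?_
    by_cases hj : b j = β
    · simp only [if_pos hj]
      exact inAGE_smul n T β _ (ht j) _ (hj ▸ hu j)
    · simp only [if_neg hj]
      exact inAGE_zero n T β
  · rw [hv α hα, Finset.sum_comm]
    refine Finset.sum_congr rfl fun j _ => ?_
    rw [Finset.sum_ite_eq, if_pos (hb j)]

/-- Sign pattern realising a prescribed sign of an odd monomial. -/
lemma exists_sign (n : ℕ) (β : Fin n → ℕ) (hβ : ∃ i, Odd (β i)) (d : ℝ) (y : Fin n → ℝ) :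
    ∃ x : Fin n → ℝ, (∀ i, |x i| = Real.exp (y i)) ∧
      d * ∏ i, x i ^ β i = -|d| * Real.exp (∑ i, natEmb n β i * y i) := by
  obtain ⟨i₀, hi₀⟩ := hβ
  have hexp : Real.exp (∑ i, natEmb n β i * y i) = ∏ i, Real.exp (y i) ^ β i := by
    rw [Real.exp_sum]
    refine Finset.prod_congr rfl fun i _ => ?_
    rw [natEmb, ← Real.exp_nat_mul]
  by_cases hd : d ≤ 0
  · refine ⟨fun i => Real.exp (y i), fun i => abs_of_pos (Real.exp_pos _), ?_⟩
    rw [hexp, abs_of_nonpos hd, neg_neg]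
  · push Not at hd
    refine ⟨fun i => (if i = i₀ then -1 else 1) * Real.exp (y i), fun i => ?_, ?_⟩
    · rw [abs_mul, abs_of_pos (Real.exp_pos _)]
      split_ifs <;> simp
    · rw [hexp, abs_of_pos hd]
      simp only [mul_pow, Finset.prod_mul_distrib]
      have : ∏ i, (if i = i₀ then (-1 : ℝ) else 1) ^ β i = -1 := by
        rw [Finset.prod_eq_single i₀]
        · simp [hi₀.neg_one_pow]
        · intro i _ hi
          simp [hi]
        · simp
      rw [this]; ring

lemma AG_to_AGE (n : ℕ) (A : Finset (Fin n → ℝ)) (hA : A.Nonempty)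
    (B : Finset (Fin n → ℕ)) (hBodd : ∀ β ∈ B, ∃ i, Odd (β i))
    (hdisj : ∀ β ∈ B, natEmb n β ∉ A)
    (c : (Fin n → ℝ) → ℝ) (d : (Fin n → ℕ) → ℝ) (h : IsNonnegAG n A B c d) :
    ∃ γ ∈ A ∪ B.image (natEmb n), InAGE n (A ∪ B.image (natEmb n)) γ
      (fun γ => if γ ∈ A then c γ
            else ∑ β ∈ B.filter (fun β => natEmb n β = γ), -|d β|) := by
  have hkey : ∀ y : Fin n → ℝ, ∑ γ ∈ A ∪ B.image (natEmb n),
      (if γ ∈ A then c γ else ∑ β ∈ B.filter (fun β => natEmb n β = γ), -|d β|)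
        * Real.exp (∑ i, γ i * y i)
      = ∑ α ∈ A, c α * Real.exp (∑ i, α i * y i)
        + ∑ β ∈ B, -|d β| * Real.exp (∑ i, natEmb n β i * y i) := by
    intro y
    rw [sum_split n A B hdisj]
    congr 1
    · exact Finset.sum_congr rfl fun α hα => by rw [if_pos hα]
    · exact Finset.sum_congr rfl fun β hβ => by
        rw [if_neg (hdisj β hβ), sum_filter_natEmb n B (fun β => -|d β|) β hβ]
  have hx : ∀ x y : Fin n → ℝ, (∀ i, |x i| = Real.exp (y i)) →
      0 ≤ ∑ α ∈ A, c α * Real.exp (∑ i, α i * y i) + ∑ β ∈ B, d β * ∏ i, x i ^ β i := by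
    intro x y hxy
    have hx0 : ∀ i, x i ≠ 0 := fun i => abs_pos.1 (by rw [hxy i]; exact Real.exp_pos _)
    have := h.2 x hx0
    simp only [prod_abs_eq n x hx0] at this
    simp only [hxy, Real.log_exp] at this
    exact this
  rcases h.1 with ⟨hd, hc⟩ | ⟨hc, hd⟩
  · -- even case
    obtain ⟨γ, hγ, hγ'⟩ : ∃ γ ∈ A, ∀ α ∈ A, α ≠ γ → 0 ≤ c α := by
      by_cases hneg : ∃ γ ∈ A, c γ < 0
      · obtain ⟨γ, hγ, hcγ⟩ := hneg
        refine ⟨γ, hγ, fun α hα hne => ?_⟩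
        by_contra hlt
        push Not at hlt
        exact hne (Finset.card_le_one.1 hc α (Finset.mem_filter.2 ⟨hα, hlt⟩) γ
          (Finset.mem_filter.2 ⟨hγ, hcγ⟩))
      · push Not at hneg
        obtain ⟨γ, hγ⟩ := hA
        exact ⟨γ, hγ, fun α hα _ => hneg α hα⟩
    refine ⟨γ, Finset.mem_union_left _ hγ, fun α hα hne => ?_, fun y => ?_⟩
    · show 0 ≤ if α ∈ A then _ else _
      split_ifs with hαA
      · exact hγ' α hαA hne
      · refine Finset.sum_nonneg fun β hβ => ?_
        rw [hd β (Finset.mem_filter.1 hβ).1]; simp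
    · refine (hkey y).symm ▸ ?_
      have := hx (fun i => Real.exp (y i)) y (fun i => abs_of_pos (Real.exp_pos _))
      have e1 : ∑ β ∈ B, d β * ∏ i, Real.exp (y i) ^ β i = 0 :=
        Finset.sum_eq_zero fun β hβ => by rw [hd β hβ, zero_mul]
      have e2 : ∑ β ∈ B, -|d β| * Real.exp (∑ i, natEmb n β i * y i) = 0 :=
        Finset.sum_eq_zero fun β hβ => by rw [hd β hβ]; simp
      rw [e2]
      rw [e1] at this
      exact this
  · by_cases hne : ∃ β ∈ B, d β ≠ 0
    · obtain ⟨β, hβ, hdβ⟩ := hne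
      have hz : ∀ b ∈ B, b ≠ β → d b = 0 := by
        intro b hb hne
        by_contra hb0
        exact hne (Finset.card_le_one.1 hd b (Finset.mem_filter.2 ⟨hb, hb0⟩) β
          (Finset.mem_filter.2 ⟨hβ, hdβ⟩))
      refine ⟨natEmb n β, Finset.mem_union_right _ (Finset.mem_image_of_mem _ hβ),
        fun α hα hne => ?_, fun y => ?_⟩
      · show 0 ≤ if α ∈ A then _ else _
        split_ifs with hαA
        · exact hc α hαA
        · refine Finset.sum_nonneg fun b hb => ?_
          have hb' := Finset.mem_filter.1 hb
          rw [hz b hb'.1 (by rintro rfl; exact hne hb'.2.symm)]; simp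
      · refine (hkey y).symm ▸ ?_
        obtain ⟨x, hx1, hx2⟩ := exists_sign n β (hBodd β hβ) (d β) y
        have := hx x y hx1
        rw [Finset.sum_eq_single_of_mem β hβ (fun b hb hne => by rw [hz b hb hne, zero_mul]),
          hx2] at this
        rw [Finset.sum_eq_single_of_mem β hβ (fun b hb hne => by rw [hz b hb hne]; simp)]
        exact this
    · push Not at hne
      obtain ⟨γ, hγ⟩ := hA
      refine ⟨γ, Finset.mem_union_left _ hγ, ?_⟩
      have hnn : ∀ α, 0 ≤ (if α ∈ A then c α
            else ∑ β ∈ B.filter (fun β => natEmb n β = α), -|d β|) := by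
        intro α
        split_ifs with hαA
        · exact hc α hαA
        · refine Finset.sum_nonneg fun b hb => ?_
          rw [hne b (Finset.mem_filter.1 hb).1]; simp
      exact ⟨fun α _ _ => hnn α, fun y => Finset.sum_nonneg fun α _ =>
        mul_nonneg (hnn α) (Real.exp_pos _).le⟩

/-- `(c, d)` lies in the S-cone `C_S(A, B)` iff there exists `t ∈ ℝ^B` with
`t_β ≤ −|d_β|` for all `β ∈ B` such that `(c, t)` lies in `C_SAGE(A ∪ B)`. -/
theorem stmt6 (n : ℕ) (A : Finset (Fin n → ℝ)) (hA : A.Nonempty)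
    (B : Finset (Fin n → ℕ)) (hBodd : ∀ β ∈ B, ∃ i, Odd (β i))
    (hdisj : ∀ β ∈ B, natEmb n β ∉ A)
    (c : (Fin n → ℝ) → ℝ) (d : (Fin n → ℕ) → ℝ) :
    InSCone n A B c d ↔
      ∃ t : (Fin n → ℕ) → ℝ,
        (∀ β ∈ B, t β ≤ -|d β|) ∧
        InSAGE n (A ∪ B.image (natEmb n))
          (fun γ => if γ ∈ A then c γ
            else ∑ β ∈ B.filter (fun β => natEmb n β = γ), t β) := by
  constructor
  · rintro ⟨k, cs, ds, s, h1, h2, h3⟩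
    refine ⟨fun β => ∑ j, s j * -|ds j β|, fun β hβ => ?_, ?_⟩
    · rw [h3 β hβ]
      have := Finset.abs_sum_le_sum_abs (fun j => s j * ds j β) Finset.univ
      simp only [abs_mul, abs_of_nonneg (h1 _).1] at this
      simp only [mul_neg, Finset.sum_neg_distrib]
      linarith
    · refine inSAGE_comb n _ k (fun j γ => if γ ∈ A then cs j γ
            else ∑ β ∈ B.filter (fun β => natEmb n β = γ), -|ds j β|) s (fun j => (h1 j).1)
        (fun j => AG_to_AGE n A hA B hBodd hdisj _ _ (h1 j).2) _ ?_
      intro α _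
      by_cases hα : α ∈ A
      · simp only [if_pos hα]
        exact h2 α hα
      · simp only [if_neg hα]
        rw [Finset.sum_comm]
        exact Finset.sum_congr rfl fun j _ => (Finset.mul_sum _ _ _).symm
  · rintro ⟨t, ht, hS⟩
    obtain ⟨w, h1, h2, h3⟩ := elim_step n _ _ hS (B.image (natEmb n))
      Finset.subset_union_right (by
        intro k hk
        obtain ⟨β, hβ, rfl⟩ := Finset.mem_image.1 hk
        show (if natEmb n β ∈ A then _ else _) ≤ 0
        rw [if_neg (hdisj β hβ), sum_filter_natEmb n B t β hβ]
        have := ht β hβ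
        have := abs_nonneg (d β)
        linarith)
    set T := A ∪ B.image (natEmb n) with hT
    have hBT : ∀ β ∈ B, natEmb n β ∈ T := fun β hβ =>
      Finset.mem_union_right _ (Finset.mem_image_of_mem _ hβ)
    have hz : ∀ β ∈ B, ∀ γ ∈ T, γ ≠ natEmb n β → w γ (natEmb n β) = 0 := fun β hβ =>
      h3 _ (Finset.mem_image_of_mem _ hβ)
    have hdiag : ∀ β ∈ B, w (natEmb n β) (natEmb n β) = t β := by
      intro β hβ
      have := h2 _ (hBT β hβ)
      simp only [if_neg (hdisj β hβ)] at this
      rw [sum_filter_natEmb n B t β hβ,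
        Finset.sum_eq_single_of_mem _ (hBT β hβ) (fun γ hγ hne => hz β hβ γ hγ hne)] at this
      exact this.symm
    have e := T.equivFin
    have hreidx : ∀ f : (Fin n → ℝ) → ℝ, ∑ j, f (e.symm j) = ∑ γ ∈ T, f γ := by
      intro f
      rw [Equiv.sum_comp e.symm (fun γ : T => f γ), Finset.sum_coe_sort T f]
    refine ⟨T.card, fun j => w (e.symm j), fun j β => if natEmb n β = e.symm j then d β else 0,
      fun _ => 1, fun j => ⟨zero_le_one, ?_⟩, fun α hα => ?_, fun β hβ => ?_⟩
    · have hγ : ((e.symm j : T) : Fin n → ℝ) ∈ T := (e.symm j).2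
      show IsNonnegAG n A B (w (e.symm j)) (fun β => if natEmb n β = e.symm j then d β else 0)
      generalize ((e.symm j : T) : Fin n → ℝ) = γ at hγ ⊢
      refine ⟨?_, fun x hx => ?_⟩
      · by_cases hγA : γ ∈ A
        · left
          refine ⟨fun β hβ => if_neg ?_, ?_⟩
          · rintro rfl
            exact hdisj β hβ hγA
          · have hall : ∀ a ∈ A.filter (fun α => w γ α < 0), a = γ := by
              intro a ha
              obtain ⟨ha, hlt⟩ := Finset.mem_filter.1 ha
              by_contra hne
              exact absurd ((h1 γ hγ).1 a (Finset.mem_union_left _ ha) hne) (not_le.2 hlt)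
            exact Finset.card_le_one.2 fun a ha b hb => (hall a ha).trans (hall b hb).symm
        · right
          refine ⟨fun α hα => (h1 γ hγ).1 α (Finset.mem_union_left _ hα)
            (fun h => hγA (h ▸ hα)), Finset.card_le_one.2 fun a ha b hb => ?_⟩
          have ha' := (Finset.mem_filter.1 ha).2
          have hb' := (Finset.mem_filter.1 hb).2
          simp only [ne_eq, ite_eq_right_iff, Classical.not_imp] at ha' hb'
          exact natEmb_inj n (ha'.1.trans hb'.1.symm)
      · have hp := (h1 γ hγ).2 (fun i => Real.log |x i|)
        rw [hT, sum_split n A B hdisj] at hp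
        simp only [prod_abs_eq n x hx]
        refine hp.trans (add_le_add le_rfl (Finset.sum_le_sum fun β hβ => ?_))
        rw [← abs_prod_eq n x hx]
        by_cases hβγ : natEmb n β = γ
        · subst hβγ
          rw [if_pos rfl, hdiag β hβ]
          calc t β * |∏ i, x i ^ β i| ≤ -|d β| * |∏ i, x i ^ β i| :=
                mul_le_mul_of_nonneg_right (ht β hβ) (abs_nonneg _)
            _ = -|d β * ∏ i, x i ^ β i| := by rw [abs_mul]; ring
            _ ≤ _ := neg_abs_le _
        · rw [if_neg hβγ, hz β hβ γ hγ (Ne.symm hβγ)]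
          simp
    · have := h2 α (Finset.mem_union_left _ hα)
      simp only [if_pos hα] at this
      simp only [one_mul]
      rw [this, ← hreidx (fun γ => w γ α)]
    · simp only [one_mul]
      rw [hreidx (fun γ => if natEmb n β = γ then d β else 0), Finset.sum_ite_eq,
        if_pos (hBT β hβ)]
end
end

section
/- Let (A, β) be a rational circuit in ℝⁿ with A ⊆ ℚⁿ, where β ∈ ℕⁿ has at least one odd coordinate, with λ_α = p_α/p, m = ⌈log₂ p⌉, leaf assignment σ, and Λ = ∏_{α∈A} λ_α^{λ_α}. A vector c ∈ ℝ^{A∪{β}} with c_α ≥ 0 for all α ∈ A lies in Pᵒ(A, β) if and only if there exist a real number x_β and real numbers x_{k,i} (1 ≤ k ≤ m, 1 ≤ i ≤ 2^{m−k}) such that, setting x_{0,j} := c_{σ(j)} if σ(j) ∈ A and x_{0,j} := Λ·x_β if σ(j) = β, one has: all values x_{k,i} (0 ≤ k ≤ m) are nonnegative; x_β ≥ |c_β|; x_{m,1} ≥ Λ·x_β; and x_{k,i}² ≤ x_{k−1,2i−1}·x_{k−1,2i} for all 1 ≤ k ≤ m, 1 ≤ i ≤ 2^{m−k}. -/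
attribute [local instance] Classical.propDecidable

noncomputable section

/-- Prescribing values of an affine function on an affinely independent set. -/
theorem aux_affine {n : ℕ} (A : Finset (Fin n → ℝ))
    (hind : AffineIndependent ℝ (fun x : A => (x : Fin n → ℝ)))
    (d : (Fin n → ℝ) → ℝ) :
    ∃ (y : Fin n → ℝ) (b : ℝ), ∀ α ∈ A, ∑ i, α i * y i = b + d α := by
  rcases A.eq_empty_or_nonempty with rfl | ⟨α0, h0⟩
  · exact ⟨0, 0, by simp⟩
  have hl := (affineIndependent_iff_linearIndependent_vsub ℝ _ (⟨α0, h0⟩ : A)).1 hind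
  have hl' := hl
  rw [LinearIndependent, ← LinearMap.ker_eq_bot] at hl'
  obtain ⟨g, hg⟩ := LinearMap.exists_leftInverse_of_injective _ hl'
  let f : (Fin n → ℝ) →ₗ[ℝ] ℝ := (Finsupp.linearCombination ℝ
    (fun a : {x : A // x ≠ ⟨α0, h0⟩} => d a.1 - d α0)) ∘ₗ g
  have hf : ∀ a : {x : A // x ≠ ⟨α0, h0⟩}, f ((a.1 : Fin n → ℝ) - α0) = d a.1 - d α0 := by
    intro a
    have h1 := LinearMap.congr_fun hg (Finsupp.single a 1)
    simp only [LinearMap.comp_apply, Finsupp.linearCombination_single, one_smul,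
      LinearMap.id_apply, vsub_eq_sub] at h1
    simp [f, h1]
  have hfy : ∀ v : Fin n → ℝ, ∑ i, v i * f (Pi.single i 1) = f v := by
    intro v
    conv_rhs => rw [LinearMap.pi_apply_eq_sum_univ f v]
    refine Finset.sum_congr rfl fun i _ => ?_
    rw [smul_eq_mul]
    congr 2
    ext j
    simp [Pi.single_apply, eq_comm]
  refine ⟨fun i => f (Pi.single i 1), f α0 - d α0, fun α hα => ?_⟩
  rw [hfy]
  by_cases h : α = α0
  · subst h; ring
  · have := hf ⟨⟨α, hα⟩, by simpa using h⟩
    simp only [map_sub] at this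
    linarith

theorem aux_prod_double (f : ℕ → ℝ) (N : ℕ) :
    ∏ i ∈ Finset.Icc 1 (2 * N), f i = ∏ i ∈ Finset.Icc 1 N, (f (2 * i - 1) * f (2 * i)) := by
  induction N with
  | zero => simp
  | succ N ih =>
    rw [show 2 * (N + 1) = 2 * N + 1 + 1 by ring, Finset.prod_Icc_succ_top (by omega),
      Finset.prod_Icc_succ_top (by omega), ih, Finset.prod_Icc_succ_top (by omega)]
    rw [show 2 * (N + 1) - 1 = 2 * N + 1 by omega, show 2 * (N + 1) = 2 * N + 1 + 1 by ring]
    ring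

theorem aux_tree_le (m : ℕ) (x : ℕ → ℕ → ℝ)
    (h1 : ∀ k, 1 ≤ k → k ≤ m → ∀ i ∈ Finset.Icc 1 (2 ^ (m - k)),
          (x k i) ^ 2 ≤ x (k - 1) (2 * i - 1) * x (k - 1) (2 * i)) :
    ∀ k, k ≤ m → (∏ i ∈ Finset.Icc 1 (2 ^ (m - k)), x k i) ^ (2 ^ k) ≤
      ∏ i ∈ Finset.Icc 1 (2 ^ m), x 0 i := by
  intro k
  induction k with
  | zero => simp
  | succ k ih =>
    intro hk
    refine le_trans ?_ (ih (by omega))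
    rw [show m - k = (m - (k + 1)) + 1 by omega, pow_succ' 2 (m - (k+1)), aux_prod_double,
      pow_succ' 2 k, pow_mul, ← Finset.prod_pow]
    refine pow_le_pow_left₀ (Finset.prod_nonneg fun i _ => sq_nonneg _) ?_ _
    exact Finset.prod_le_prod (fun i _ => sq_nonneg _) fun i hi => h1 (k + 1) (by omega) hk i hi

/-- the tree of geometric means -/
def auxTree (f : ℕ → ℝ) : ℕ → ℕ → ℝ
  | 0 => f
  | k + 1 => fun i => Real.sqrt (auxTree f k (2 * i - 1) * auxTree f k (2 * i))

theorem auxTree_nonneg (m : ℕ) (f : ℕ → ℝ) (hf : ∀ i ∈ Finset.Icc 1 (2 ^ m), 0 ≤ f i) :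
    ∀ k, k ≤ m → ∀ i ∈ Finset.Icc 1 (2 ^ (m - k)), 0 ≤ auxTree f k i := by
  intro k
  cases k with
  | zero => intro _; simpa [auxTree] using hf
  | succ k => intro _ i _; exact Real.sqrt_nonneg _

theorem auxTree_sq (m : ℕ) (f : ℕ → ℝ) (hf : ∀ i ∈ Finset.Icc 1 (2 ^ m), 0 ≤ f i) :
    ∀ k, 1 ≤ k → k ≤ m → ∀ i ∈ Finset.Icc 1 (2 ^ (m - k)),
      (auxTree f k i) ^ 2 = auxTree f (k - 1) (2 * i - 1) * auxTree f (k - 1) (2 * i) := by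
  intro k hk hkm i hi
  obtain ⟨k, rfl⟩ : ∃ l, k = l + 1 := ⟨k - 1, by omega⟩
  have hn := auxTree_nonneg m f hf k (by omega)
  have e : 2 ^ (m - k) = 2 * 2 ^ (m - (k + 1)) := by
    rw [← pow_succ']; congr 1; omega
  rw [Finset.mem_Icc] at hi
  simp only [Nat.add_sub_cancel]
  refine Real.sq_sqrt (mul_nonneg (hn _ ?_) (hn _ ?_)) <;> rw [Finset.mem_Icc, e] <;> omega

theorem auxTree_prod (m : ℕ) (f : ℕ → ℝ) (hf : ∀ i ∈ Finset.Icc 1 (2 ^ m), 0 ≤ f i) :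
    ∀ k, k ≤ m → (∏ i ∈ Finset.Icc 1 (2 ^ (m - k)), auxTree f k i) ^ (2 ^ k) =
      ∏ i ∈ Finset.Icc 1 (2 ^ m), f i := by
  intro k
  induction k with
  | zero => simp [auxTree]
  | succ k ih =>
    intro hk
    rw [← ih (by omega)]
    rw [show m - k = (m - (k + 1)) + 1 by omega, pow_succ' 2 (m - (k+1)), aux_prod_double,
      pow_succ' 2 k, pow_mul, ← Finset.prod_pow]
    congr 1
    exact Finset.prod_congr rfl fun i hi => auxTree_sq m f hf (k + 1) (by omega) hk i hi

/-- Passing to exponential coordinates. -/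
theorem aux_exp {n : ℕ} (A : Finset (Fin n → ℝ)) (β : Fin n → ℕ) (hodd : ∃ i, Odd (β i))
    (c : (Fin n → ℝ) → ℝ) (cb : ℝ) :
    (∀ x : Fin n → ℝ, (∀ i, x i ≠ 0) →
        0 ≤ ∑ α ∈ A, c α * ∏ i, |x i| ^ (α i) + cb * ∏ i, x i ^ (β i)) ↔
    ∀ y : Fin n → ℝ, |cb| * Real.exp (∑ i, (β i : ℝ) * y i) ≤
      ∑ α ∈ A, c α * Real.exp (∑ i, α i * y i) := by
  have key : ∀ x : Fin n → ℝ, (∀ i, x i ≠ 0) → ∀ α : Fin n → ℝ,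
      ∏ i, |x i| ^ (α i) = Real.exp (∑ i, α i * Real.log |x i|) := by
    intro x hx α
    rw [Real.exp_sum]
    refine Finset.prod_congr rfl fun i _ => ?_
    rw [Real.rpow_def_of_pos (abs_pos.2 (hx i)), mul_comm]
  have keyb : ∀ x : Fin n → ℝ, (∀ i, x i ≠ 0) →
      |∏ i, x i ^ (β i)| = Real.exp (∑ i, (β i : ℝ) * Real.log |x i|) := by
    intro x hx
    rw [← key x hx, Finset.abs_prod]
    refine Finset.prod_congr rfl fun i _ => ?_
    rw [abs_pow, Real.rpow_natCast]
  constructor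
  · intro h y
    obtain ⟨i0, hi0⟩ := hodd
    have hx1 : ∀ i, Real.exp (y i) ≠ 0 := fun i => (Real.exp_pos _).ne'
    let x2 : Fin n → ℝ := fun i => if i = i0 then -Real.exp (y i) else Real.exp (y i)
    have hx2 : ∀ i, x2 i ≠ 0 := by
      intro i; simp only [x2]; split_ifs <;> simp [Real.exp_ne_zero]
    have habs : ∀ i, |x2 i| = Real.exp (y i) := by
      intro i; simp only [x2]; split_ifs <;> simp
    have e1 := h (fun i => Real.exp (y i)) hx1
    have e2 := h x2 hx2
    have p1 : ∏ i, Real.exp (y i) ^ (β i) = Real.exp (∑ i, (β i : ℝ) * y i) := by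
      rw [Real.exp_sum]
      exact Finset.prod_congr rfl fun i _ => by rw [← Real.exp_nat_mul]
    have p2 : ∏ i, x2 i ^ (β i) = - Real.exp (∑ i, (β i : ℝ) * y i) := by
      rw [← p1, ← Finset.mul_prod_erase _ _ (Finset.mem_univ i0),
        ← Finset.mul_prod_erase _ (fun i => Real.exp (y i) ^ (β i)) (Finset.mem_univ i0)]
      have : ∏ i ∈ Finset.univ.erase i0, x2 i ^ β i
          = ∏ i ∈ Finset.univ.erase i0, Real.exp (y i) ^ β i := by
        refine Finset.prod_congr rfl fun i hi => ?_
        simp [x2, Finset.ne_of_mem_erase hi]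
      rw [this]
      simp [x2, hi0.neg_pow]
    simp only [p1] at e1
    rw [p2] at e2
    simp only [key _ hx1] at e1
    simp only [key _ hx2] at e2
    simp only [habs] at e2
    simp only [Real.abs_exp, Real.log_exp] at e1 e2
    rcases abs_cases cb with ⟨h', _⟩ | ⟨h', _⟩ <;> rw [h'] <;> linarith
  · intro h x hx
    have h1 := h (fun i => Real.log |x i|)
    simp only [key x hx]
    rw [← keyb x hx, ← abs_mul] at h1
    have := neg_abs_le (cb * ∏ i, x i ^ (β i))
    linarith

theorem aux_pow_Lam {ι : Type*} (A : Finset ι) (p : ℕ) (hp : 0 < p) (pA : ι → ℕ) (z : ι → ℝ)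
    (hz : ∀ a ∈ A, 0 ≤ z a) :
    (∏ a ∈ A, z a ^ ((pA a : ℝ) / p)) ^ p = ∏ a ∈ A, z a ^ pA a := by
  rw [← Finset.prod_pow]
  refine Finset.prod_congr rfl fun a ha => ?_
  rw [← Real.rpow_natCast, ← Real.rpow_mul (hz a ha), div_mul_cancel₀, Real.rpow_natCast]
  exact_mod_cast hp.ne'

theorem aux_agm {n : ℕ} (A : Finset (Fin n → ℝ)) (b : Fin n → ℝ)
    (hind : AffineIndependent ℝ (fun x : A => (x : Fin n → ℝ)))
    (p : ℕ) (pA : (Fin n → ℝ) → ℕ) (hp : 0 < p) (hpA : ∀ α ∈ A, 0 < pA α)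
    (hpsum : ∑ α ∈ A, pA α = p)
    (hbary : ∑ α ∈ A, ((pA α : ℝ) / p) • α = b)
    (Λ : ℝ) (hΛ : Λ = ∏ α ∈ A, ((pA α : ℝ) / p) ^ ((pA α : ℝ) / p))
    (c : (Fin n → ℝ) → ℝ) (hc : ∀ α ∈ A, 0 ≤ c α) (t : ℝ) (ht : 0 ≤ t) :
    (∀ y : Fin n → ℝ, t * Real.exp (∑ i, b i * y i) ≤
      ∑ α ∈ A, c α * Real.exp (∑ i, α i * y i)) ↔
    (Λ * t) ^ p ≤ ∏ α ∈ A, c α ^ pA α := by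
  have hpR : (0 : ℝ) < p := by exact_mod_cast hp
  have hlam : ∀ α ∈ A, (0 : ℝ) < (pA α : ℝ) / p := fun α hα =>
    div_pos (by exact_mod_cast hpA α hα) hpR
  have hlsum : ∑ α ∈ A, (pA α : ℝ) / p = 1 := by
    rw [← Finset.sum_div, div_eq_one_iff_eq hpR.ne']
    exact_mod_cast hpsum
  have hLp : Λ ^ p = ∏ α ∈ A, ((pA α : ℝ) / p) ^ pA α := by
    rw [hΛ]; exact aux_pow_Lam A p hp pA _ fun a ha => (hlam a ha).le
  have hLp0 : 0 < Λ ^ p := by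
    rw [hLp]; exact Finset.prod_pos fun a ha => pow_pos (hlam a ha) _
  have hby : ∀ y : Fin n → ℝ, ∑ i, b i * y i = ∑ α ∈ A, (pA α : ℝ) / p * ∑ i, α i * y i := by
    intro y
    simp only [Finset.mul_sum]
    rw [Finset.sum_comm, ← hbary]
    refine Finset.sum_congr rfl fun i _ => ?_
    rw [Finset.sum_apply, Finset.sum_mul]
    exact Finset.sum_congr rfl fun α _ => by simp [mul_assoc]
  have hexp : ∀ y : Fin n → ℝ, Real.exp (∑ i, b i * y i) ^ p =
      ∏ α ∈ A, Real.exp (∑ i, α i * y i) ^ pA α := by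
    intro y
    simp only [← Real.exp_nat_mul]
    rw [← Real.exp_sum, hby, Finset.mul_sum]
    congr 1
    refine Finset.sum_congr rfl fun α _ => ?_
    field_simp
  constructor
  · intro h
    -- positive case
    have pos : ∀ c' : (Fin n → ℝ) → ℝ, (∀ α ∈ A, 0 < c' α) →
        (∀ y : Fin n → ℝ, t * Real.exp (∑ i, b i * y i) ≤
          ∑ α ∈ A, c' α * Real.exp (∑ i, α i * y i)) →
        (Λ * t) ^ p ≤ ∏ α ∈ A, c' α ^ pA α := by
      intro c' hc' h'
      obtain ⟨y, s, hy⟩ := aux_affine A hind (fun α => Real.log ((pA α : ℝ) / p / c' α))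
      have hE : ∀ α ∈ A, c' α * Real.exp (∑ i, α i * y i) = (pA α : ℝ) / p * Real.exp s := by
        intro α hα
        rw [hy α hα, Real.exp_add, Real.exp_log (div_pos (hlam α hα) (hc' α hα))]
        have := (hc' α hα).ne'
        field_simp
      have h1 := h' y
      rw [Finset.sum_congr rfl hE, ← Finset.sum_mul, hlsum, one_mul] at h1
      have h2 := pow_le_pow_left₀ (mul_nonneg ht (Real.exp_pos _).le) h1 p
      rw [mul_pow, hexp] at h2
      have hsp : Real.exp s ^ p = ∏ α ∈ A, Real.exp s ^ pA α := by
        rw [Finset.prod_pow_eq_pow_sum, hpsum]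
      have h3 : (∏ α ∈ A, c' α ^ pA α) * (∏ α ∈ A, Real.exp (∑ i, α i * y i) ^ pA α)
          = Λ ^ p * Real.exp s ^ p := by
        rw [hLp, hsp, ← Finset.prod_mul_distrib, ← Finset.prod_mul_distrib]
        exact Finset.prod_congr rfl fun α hα => by rw [← mul_pow, hE α hα, mul_pow]
      have hP : 0 < ∏ α ∈ A, Real.exp (∑ i, α i * y i) ^ pA α :=
        Finset.prod_pos fun _ _ => pow_pos (Real.exp_pos _) _
      refine le_of_mul_le_mul_right ?_ hP
      rw [h3, mul_pow, mul_assoc]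
      exact mul_le_mul_of_nonneg_left h2 hLp0.le
    have hcont : Filter.Tendsto (fun e : ℝ => ∏ α ∈ A, (c α + e) ^ pA α)
        (nhdsWithin 0 (Set.Ioi 0)) (nhds (∏ α ∈ A, (c α + 0) ^ pA α)) := by
      have : Continuous (fun e : ℝ => ∏ α ∈ A, (c α + e) ^ pA α) := by fun_prop
      exact (this.tendsto 0).mono_left nhdsWithin_le_nhds
    simp only [add_zero] at hcont
    refine ge_of_tendsto hcont ?_
    filter_upwards [self_mem_nhdsWithin] with e he
    have he' : (0 : ℝ) < e := he
    refine pos (fun α => c α + e) (fun α hα => by have := hc α hα; linarith) fun y => ?_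
    refine (h y).trans (Finset.sum_le_sum fun α _ => ?_)
    exact mul_le_mul_of_nonneg_right (by linarith) (Real.exp_pos _).le
  · intro h y
    have hz : ∀ α ∈ A, 0 ≤ c α * Real.exp (∑ i, α i * y i) / ((pA α : ℝ) / p) := fun α hα =>
      div_nonneg (mul_nonneg (hc α hα) (Real.exp_pos _).le) (hlam α hα).le
    have am := Real.geom_mean_le_arith_mean_weighted A (fun α => (pA α : ℝ) / p)
      (fun α => c α * Real.exp (∑ i, α i * y i) / ((pA α : ℝ) / p))
      (fun α hα => (hlam α hα).le) hlsum hz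
    have hs : ∑ α ∈ A, (pA α : ℝ) / p * (c α * Real.exp (∑ i, α i * y i) / ((pA α : ℝ) / p))
        = ∑ α ∈ A, c α * Real.exp (∑ i, α i * y i) :=
      Finset.sum_congr rfl fun α hα => mul_div_cancel₀ _ (hlam α hα).ne'
    rw [hs] at am
    refine le_trans ?_ am
    refine le_of_pow_le_pow_left₀ hp.ne' (Finset.prod_nonneg fun α hα =>
      Real.rpow_nonneg (hz α hα) _) ?_
    rw [aux_pow_Lam A p hp pA _ hz]
    simp only [div_pow, mul_pow]
    rw [hexp, Finset.prod_div_distrib, Finset.prod_mul_distrib]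
    simp only [← div_pow]
    rw [← hLp, le_div_iff₀ hLp0]
    rw [mul_pow] at h
    calc t ^ p * _ * Λ ^ p = (Λ ^ p * t ^ p) * _ := by ring
      _ ≤ _ := mul_le_mul_of_nonneg_right h
        (Finset.prod_nonneg fun _ _ => pow_nonneg (Real.exp_pos _).le _)

/-- Second-order (binary tree) characterization of the primal cone `Pᵒ(A, β)` of
nonnegative odd AG functions on a rational circuit `(A, β)` with `A ⊆ ℚⁿ`,
`β ∈ ℕⁿ` having an odd coordinate, leaf assignment `σ` and `Λ = ∏_{α ∈ A} λ_α^{λ_α}`. -/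
theorem stmt16 (n : ℕ) (A : Finset (Fin n → ℝ))
    (hArat : ∀ α ∈ A, ∀ i, ∃ q : ℚ, α i = (q : ℝ))
    (β : Fin n → ℕ) (hodd : ∃ i, Odd (β i))
    (hβA : (fun i => (β i : ℝ)) ∉ A)
    (hind : AffineIndependent ℝ (fun x : A => (x : Fin n → ℝ)))
    (p : ℕ) (pA : (Fin n → ℝ) → ℕ) (hp : 0 < p) (hpA : ∀ α ∈ A, 0 < pA α)
    (hpsum : ∑ α ∈ A, pA α = p)
    (hbary : ∑ α ∈ A, ((pA α : ℝ) / p) • α = fun i => (β i : ℝ))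
    (m : ℕ) (hm : m = Nat.clog 2 p)
    (σ : ℕ → (Fin n → ℝ))
    (hσmem : ∀ j ∈ Finset.Icc 1 (2 ^ m), σ j ∈ A ∨ σ j = fun i => (β i : ℝ))
    (hσA : ∀ α ∈ A, ((Finset.Icc 1 (2 ^ m)).filter fun j => σ j = α).card = pA α)
    (hσβ : ((Finset.Icc 1 (2 ^ m)).filter
      fun j => σ j = fun i => (β i : ℝ)).card = 2 ^ m - p)
    (Λ : ℝ) (hΛ : Λ = ∏ α ∈ A, ((pA α : ℝ) / p) ^ ((pA α : ℝ) / p))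
    (c : (Fin n → ℝ) → ℝ) (hc : ∀ α ∈ A, 0 ≤ c α) :
    (∀ x : Fin n → ℝ, (∀ i, x i ≠ 0) →
        0 ≤ ∑ α ∈ A, c α * ∏ i, |x i| ^ (α i)
              + c (fun i => (β i : ℝ)) * ∏ i, x i ^ (β i)) ↔
      ∃ (xβ : ℝ) (x : ℕ → ℕ → ℝ),
        (∀ j ∈ Finset.Icc 1 (2 ^ m),
          x 0 j = if σ j ∈ A then c (σ j) else Λ * xβ) ∧
        (∀ k, k ≤ m → ∀ i ∈ Finset.Icc 1 (2 ^ (m - k)), 0 ≤ x k i) ∧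
        |c (fun i => (β i : ℝ))| ≤ xβ ∧
        Λ * xβ ≤ x m 1 ∧
        (∀ k, 1 ≤ k → k ≤ m → ∀ i ∈ Finset.Icc 1 (2 ^ (m - k)),
          (x k i) ^ 2 ≤ x (k - 1) (2 * i - 1) * x (k - 1) (2 * i)) := by
  rw [aux_exp A β hodd c, aux_agm A _ hind p pA hp hpA hpsum hbary Λ hΛ c hc _ (abs_nonneg _)]
  set b : Fin n → ℝ := fun i => (β i : ℝ) with hb
  have hpm : p ≤ 2 ^ m := hm ▸ Nat.le_pow_clog (by norm_num) p
  have hΛ0 : 0 < Λ := by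
    rw [hΛ]
    refine Finset.prod_pos fun a ha => Real.rpow_pos_of_pos (div_pos ?_ ?_) _
    · exact_mod_cast hpA a ha
    · exact_mod_cast hp
  have hleaf : ∀ xβ : ℝ, ∏ j ∈ Finset.Icc 1 (2 ^ m), (if σ j ∈ A then c (σ j) else Λ * xβ)
      = (Λ * xβ) ^ (2 ^ m - p) * ∏ α ∈ A, c α ^ pA α := by
    intro xβ
    rw [← Finset.prod_fiberwise_of_maps_to (s := Finset.Icc 1 (2 ^ m)) (t := insert b A) (g := σ)
      (fun j hj => by rw [Finset.mem_insert]; exact (hσmem j hj).symm),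
      Finset.prod_insert hβA]
    congr 1
    · rw [← hσβ, ← Finset.prod_const]
      refine Finset.prod_congr rfl fun j hj => ?_
      rw [(Finset.mem_filter.1 hj).2, if_neg hβA]
    · refine Finset.prod_congr rfl fun α hα => ?_
      rw [← hσA α hα, ← Finset.prod_const]
      refine Finset.prod_congr rfl fun j hj => ?_
      rw [(Finset.mem_filter.1 hj).2, if_pos hα]
  have hsplit : ∀ u : ℝ, u ^ (2 ^ m) = u ^ (2 ^ m - p) * u ^ p := by
    intro u; rw [← pow_add]; congr 1; omega
  have hP0 : 0 ≤ ∏ α ∈ A, c α ^ pA α := Finset.prod_nonneg fun α hα => pow_nonneg (hc α hα) _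
  constructor
  · intro h
    have hf : ∀ j ∈ Finset.Icc 1 (2 ^ m), 0 ≤ (if σ j ∈ A then c (σ j) else Λ * |c b|) := by
      intro j _
      split_ifs with hj
      · exact hc _ hj
      · positivity
    refine ⟨|c b|, auxTree (fun j => if σ j ∈ A then c (σ j) else Λ * |c b|),
      fun j _ => rfl, auxTree_nonneg m _ hf, le_rfl, ?_,
      fun k h1 h2 i hi => (auxTree_sq m _ hf k h1 h2 i hi).le⟩
    have hpr := auxTree_prod m _ hf m le_rfl
    rw [hleaf] at hpr
    simp only [Nat.sub_self, pow_zero, Finset.Icc_self, Finset.prod_singleton] at hpr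
    refine le_of_pow_le_pow_left₀ (n := 2 ^ m) (by positivity)
      (auxTree_nonneg m _ hf m le_rfl 1 (by simp)) ?_
    rw [hpr, hsplit]
    exact mul_le_mul_of_nonneg_left h (by positivity)
  · rintro ⟨xβ, x, hx0, hnn, hab, hroot, hsq⟩
    have hx : 0 ≤ xβ := (abs_nonneg _).trans hab
    have hmono : (Λ * |c b|) ^ p ≤ (Λ * xβ) ^ p := by gcongr
    refine hmono.trans ?_
    rcases hx.eq_or_lt with h0 | h0
    · rw [← h0, mul_zero, zero_pow hp.ne']; exact hP0
    have ht := aux_tree_le m x hsq m le_rfl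
    rw [Finset.prod_congr rfl hx0, hleaf] at ht
    simp only [Nat.sub_self, pow_zero, Finset.Icc_self, Finset.prod_singleton] at ht
    have h2 := (pow_le_pow_left₀ (by positivity) hroot (2 ^ m)).trans ht
    rw [hsplit] at h2
    exact le_of_mul_le_mul_left h2 (by positivity)
end
end
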